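/- arXiv:1304.4667 — 6 statements merged into one kernel-verified Lean document; each statement's English description precedes it below -/
import Mathlib

section
/- Let R be a commutative ring that is a ℚ-algebra, A an associative unital R-algebra, and d₁, d₂ ∈ R with d₁² = 0 and d₂² = 0. Then for all X, Y ∈ A, exp(d₁ • X) · exp(d₂ • Y) = exp(d₂ • Y) · exp(d₁ • X) · exp((d₁·d₂) • [X, Y]), where [X, Y] = X·Y − Y·X. (Paper: Proposition 5.4.) -/
/-- The truncated exponential of a nilpotent element of an `R`-algebra,
where `R` is a commutative `ℚ`-algebra: `∑ₖ aᵏ/k!`, the sum being finite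
since `a` is nilpotent.  (For non-nilpotent `a` it takes a junk value.) -/
noncomputable def nilExp (R : Type*) {A : Type*} [CommRing R] [Algebra ℚ R]
    [Ring A] [Algebra R A] (a : A) : A :=
  ∑ k ∈ Finset.range (nilpotencyClass a), (((k.factorial : ℚ))⁻¹ • (1 : R)) • a ^ k

/-- The commutator bracket `[a, b] = a * b - b * a` in an associative ring. -/
def br {A : Type*} [Ring A] (a b : A) : A := a * b - b * a

/-- For a square-zero element the truncated exponential is `1 + a`. -/
theorem nilExp_of_sq_zero (R : Type*) {A : Type*} [CommRing R] [Algebra ℚ R]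
    [Ring A] [Algebra R A] (a : A) (h : a ^ 2 = 0) : nilExp R a = 1 + a := by
  have hn : nilpotencyClass a ≤ 2 := csInf_le' h
  have hz : a ^ nilpotencyClass a = 0 := pow_nilpotencyClass ⟨2, h⟩
  have key : nilExp R a =
      ∑ k ∈ Finset.range 2, (((k.factorial : ℚ))⁻¹ • (1 : R)) • a ^ k := by
    unfold nilExp
    refine Finset.sum_subset (Finset.range_mono hn) fun k _ hk => ?_
    have hk' : nilpotencyClass a ≤ k := by simpa using hk
    rw [pow_eq_zero_of_le hk' hz, smul_zero]
  rw [key]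
  simp [Finset.sum_range_succ]

theorem exp_smul_mul_exp_smul_comm {R A : Type*} [CommRing R] [Algebra ℚ R]
    [Ring A] [Algebra R A] (d₁ d₂ : R) (h₁ : d₁ ^ 2 = 0) (h₂ : d₂ ^ 2 = 0) (X Y : A) :
    nilExp R (d₁ • X) * nilExp R (d₂ • Y) =
      nilExp R (d₂ • Y) * nilExp R (d₁ • X) * nilExp R ((d₁ * d₂) • br X Y) := by
  have e₁ : d₁ * d₁ = 0 := by rw [← sq, h₁]
  have e₂ : d₂ * d₂ = 0 := by rw [← sq, h₂]
  have e₃ : d₁ * (d₁ * d₂) = 0 := by rw [← mul_assoc, e₁, zero_mul]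
  have e₄ : d₂ * (d₁ * d₂) = 0 := by rw [mul_left_comm, e₂, mul_zero]
  have s₁ : (d₁ • X) ^ 2 = 0 := by rw [smul_pow, h₁, zero_smul]
  have s₂ : (d₂ • Y) ^ 2 = 0 := by rw [smul_pow, h₂, zero_smul]
  have s₃ : ((d₁ * d₂) • br X Y) ^ 2 = 0 := by
    rw [smul_pow, mul_pow, h₁, zero_mul, zero_smul]
  rw [nilExp_of_sq_zero R _ s₁, nilExp_of_sq_zero R _ s₂, nilExp_of_sq_zero R _ s₃]
  have x₁ : (d₁ • X) * ((d₁ * d₂) • br X Y) = 0 := by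
    rw [smul_mul_smul_comm, e₃, zero_smul]
  have x₂ : (d₂ • Y) * ((d₁ * d₂) • br X Y) = 0 := by
    rw [smul_mul_smul_comm, e₄, zero_smul]
  have x₃ : (d₁ * d₂) • br X Y = (d₁ • X) * (d₂ • Y) - (d₂ • Y) * (d₁ • X) := by
    rw [smul_mul_smul_comm, smul_mul_smul_comm, mul_comm d₂ d₁, br, smul_sub]
  have x₄ : (1 + d₂ • Y) * (1 + d₁ • X) * (1 + (d₁ * d₂) • br X Y) =
      (1 + d₂ • Y) * (1 + d₁ • X) + (d₁ * d₂) • br X Y := by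
    rw [mul_add _ 1, mul_one, mul_assoc _ _ ((d₁ * d₂) • br X Y), add_mul 1 (d₁ • X), x₁,
      one_mul, add_zero, add_mul 1 (d₂ • Y) ((d₁ * d₂) • br X Y), x₂, one_mul, add_zero]
  rw [x₄, x₃]
  generalize d₁ • X = x
  generalize d₂ • Y = y
  noncomm_ring
end

section
/- Let R be a commutative ring that is a ℚ-algebra, A an associative unital R-algebra, and d₁, d₂ ∈ R with d₁² = d₂² = 0; set s = d₁ + d₂ (so s³ = 0). Then for all X, Y ∈ A, exp(s • (X + Y)) = exp(s • X) · exp(s • Y) · exp(−(s²/2) • [X, Y]), where [X, Y] = X·Y − Y·X. (Paper: Theorem 6.2, the second-order Zassenhaus formula.) -/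
theorem nilExp_of_cube (R : Type*) {A : Type*} [CommRing R] [Algebra ℚ R]
    [Ring A] [Algebra R A] {a : A} (h : a ^ 3 = 0) :
    nilExp R a = 1 + a + ((1 / 2 : ℚ) • (1 : R)) • a ^ 2 := by
  have h1 : nilExp R a =
      ∑ k ∈ Finset.range 3, (((k.factorial : ℚ))⁻¹ • (1 : R)) • a ^ k := by
    unfold nilExp
    refine Finset.sum_subset (Finset.range_mono (csInf_le' h)) fun k _ hk => ?_
    rw [pow_eq_zero_of_le (by simpa using hk) (pow_nilpotencyClass ⟨3, h⟩), smul_zero]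
  rw [h1]
  simp [Finset.sum_range_succ, Nat.factorial]

theorem zassenhaus_order_two {R A : Type*} [CommRing R] [Algebra ℚ R]
    [Ring A] [Algebra R A] (d₁ d₂ : R) (h₁ : d₁ ^ 2 = 0) (h₂ : d₂ ^ 2 = 0) (X Y : A) :
    nilExp R ((d₁ + d₂) • (X + Y)) =
      nilExp R ((d₁ + d₂) • X) * nilExp R ((d₁ + d₂) • Y) *
        nilExp R (-(((1 / 2 : ℚ) • (d₁ + d₂) ^ 2) • br X Y)) := by
  obtain ⟨t, ht⟩ : ∃ t : R, t = (1 / 2 : ℚ) • (d₁ + d₂) ^ 2 := ⟨_, rfl⟩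
  rw [← ht]
  have hs3 : (d₁ + d₂) ^ 3 = 0 := by
    linear_combination (d₁ + 3 * d₂) * h₁ + (3 * d₁ + d₂) * h₂
  generalize d₁ + d₂ = s at *
  have hss : s * s = t + t := by
    rw [ht, ← add_smul, ← pow_two]; norm_num
  have hst : s * t = 0 := by
    rw [ht, mul_smul_comm, ← pow_succ', hs3, smul_zero]
  have hts : t * s = 0 := by rw [mul_comm, hst]
  have htt : t * t = 0 := by
    nth_rewrite 1 [ht]
    rw [smul_mul_assoc, pow_two, mul_assoc, hst, mul_zero, smul_zero]
  have key : ∀ Z : A, nilExp R (s • Z) = 1 + s • Z + t • (Z * Z) := by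
    intro Z
    rw [nilExp_of_cube R (by rw [smul_pow, hs3, zero_smul]), smul_pow, smul_smul, pow_two Z,
      smul_mul_assoc, one_mul, ← ht]
  have key2 : nilExp R (-(t • br X Y)) = 1 - t • br X Y := by
    have h2 : (-(t • br X Y)) ^ 2 = 0 := by
      rw [neg_sq, smul_pow, pow_two t, htt, zero_smul]
    rw [nilExp_of_cube R (by rw [pow_succ, h2, zero_mul]), h2, smul_zero, add_zero,
      sub_eq_add_neg]
  rw [key, key, key, key2]
  simp only [br, mul_add, add_mul, mul_sub, smul_mul_assoc, mul_smul_comm, smul_smul, one_mul,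
    mul_one, smul_add, smul_sub, hss, hst, hts, htt, zero_smul, zero_mul, mul_zero, add_smul]
  abel
end

section
/- Let R be a commutative ring that is a ℚ-algebra, A an associative unital R-algebra, and d₁, d₂ ∈ R with d₁² = d₂² = 0; set s = d₁ + d₂ (so s³ = 0). Then for all X₁, …, Xₙ ∈ A, exp(s • X₁) · exp(s • X₂) ⋯ exp(s • Xₙ) = exp(s • (X₁ + ⋯ + Xₙ) + (s²/2) • Σ_{1 ≤ i < j ≤ n} [Xᵢ, Xⱼ]), where [a, b] = a·b − b·a. (Paper: Corollary 7.2.1.) -/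
theorem nilExp_eq_sum_aux {R A : Type*} [CommRing R] [Algebra ℚ R]
    [Ring A] [Algebra R A] {a : A} (h : a ^ 3 = 0) :
    nilExp R a = 1 + a + ((1 / 2 : ℚ) • (1 : R)) • a ^ 2 := by
  have h3 : nilExp R a = ∑ k ∈ Finset.range 3, (((k.factorial : ℚ))⁻¹ • (1 : R)) • a ^ k := by
    unfold nilExp
    apply Finset.sum_subset
    · intro x hx
      rw [Finset.mem_range] at *
      exact lt_of_lt_of_le hx (csInf_le' h)
    · intro x _ hx
      rw [Finset.mem_range, not_lt] at hx
      rw [pow_eq_zero_of_le hx (pow_nilpotencyClass ⟨3, h⟩), smul_zero]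
  rw [h3]
  simp [Finset.sum_range_succ, Nat.factorial]

theorem nilExp_order_two {R A : Type*} [CommRing R] [Algebra ℚ R]
    [Ring A] [Algebra R A] (s c : R) (hs : s ^ 3 = 0) (hc : c = (1 / 2 : ℚ) • s ^ 2) (X Y : A) :
    nilExp R (s • X + c • Y) = 1 + s • X + c • (X * X + Y) := by
  have hsc : s * c = 0 := by rw [hc, mul_smul_comm, ← pow_succ', hs, smul_zero]
  have hcs : c * s = 0 := by rw [mul_comm, hsc]
  have hcc : c * c = 0 := by
    nth_rw 1 [hc]
    rw [smul_mul_assoc, pow_two, mul_assoc, hsc, mul_zero, smul_zero]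
  have h2 : (s • X + c • Y) ^ 2 = (s ^ 2) • (X * X) := by
    rw [pow_two, add_mul, mul_add, mul_add]
    simp only [smul_mul_smul_comm, hsc, hcs, hcc, zero_smul, add_zero, pow_two]
  have hq : s ^ 2 * c = 0 := by rw [pow_two, mul_assoc, hsc, mul_zero]
  have h3 : (s • X + c • Y) ^ 3 = 0 := by
    rw [pow_succ, h2, mul_add]
    simp only [smul_mul_smul_comm, hq, ← pow_succ, hs, zero_smul, add_zero]
  rw [nilExp_eq_sum_aux h3, h2, smul_smul, smul_mul_assoc, one_mul, ← hc, smul_add]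
  abel

theorem prod_order_two {R A : Type*} [CommRing R] [Algebra ℚ R]
    [Ring A] [Algebra R A] (s c : R) (hs : s ^ 3 = 0) (hc : c = (1 / 2 : ℚ) • s ^ 2)
    {n : ℕ} (X : Fin n → A) :
    (List.ofFn (fun i => nilExp R (s • X i))).prod =
      1 + s • ∑ i, X i +
        c • ((∑ i, X i) * (∑ i, X i) + ∑ i, ∑ j ∈ Finset.Ioi i, br (X i) (X j)) := by
  have hsc : s * c = 0 := by rw [hc, mul_smul_comm, ← pow_succ', hs, smul_zero]
  have hcs : c * s = 0 := by rw [mul_comm, hsc]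
  have hcc : c * c = 0 := by
    nth_rw 1 [hc]
    rw [smul_mul_assoc, pow_two, mul_assoc, hsc, mul_zero, smul_zero]
  have hss : s * s = c + c := by
    rw [hc, ← add_smul, pow_two]; norm_num
  induction n with
  | zero => simp
  | succ n ih =>
    rw [List.ofFn_succ, List.prod_cons, ih (fun i => X i.succ)]
    have e := nilExp_order_two s c hs hc (X 0) 0
    rw [smul_zero, add_zero, add_zero] at e
    rw [e, Fin.sum_univ_succ, Fin.sum_univ_succ (fun i => ∑ j ∈ Finset.Ioi i, br (X i) (X j))]
    have e0 : ∑ j ∈ Finset.Ioi (0 : Fin (n + 1)), br (X 0) (X j)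
        = br (X 0) (∑ i : Fin n, X i.succ) := by
      rw [Fin.sum_Ioi_zero]
      simp only [br, Finset.mul_sum, Finset.sum_mul, Finset.sum_sub_distrib]
    simp only [e0, Fin.sum_Ioi_succ]
    generalize ∑ i : Fin n, X i.succ = S
    generalize ∑ i : Fin n, ∑ j ∈ Finset.Ioi i, br (X i.succ) (X j.succ) = B
    simp only [add_mul, mul_add, one_mul, mul_one, smul_mul_smul_comm, hsc, hcs, hcc, hss,
      zero_smul, add_zero, br, smul_add, smul_sub, add_smul]
    abel

theorem bch_order_two_multi {R A : Type*} [CommRing R] [Algebra ℚ R]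
    [Ring A] [Algebra R A] (d₁ d₂ : R) (h₁ : d₁ ^ 2 = 0) (h₂ : d₂ ^ 2 = 0)
    {n : ℕ} (X : Fin n → A) :
    (List.ofFn (fun i => nilExp R ((d₁ + d₂) • X i))).prod =
      nilExp R ((d₁ + d₂) • ∑ i, X i +
        ((1 / 2 : ℚ) • (d₁ + d₂) ^ 2) • ∑ i, ∑ j ∈ Finset.Ioi i, br (X i) (X j)) := by
  have hs : (d₁ + d₂) ^ 3 = 0 := by
    linear_combination (d₁ + 3 * d₂) * h₁ + (3 * d₁ + d₂) * h₂
  rw [prod_order_two _ _ hs rfl, nilExp_order_two _ _ hs rfl]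
end

section
/- Let R be a commutative ring that is a ℚ-algebra, A an associative unital R-algebra, and d₁, d₂, d₃ ∈ R with dᵢ² = 0 for each i; set s = d₁ + d₂ + d₃ (so s⁴ = 0). Then for all X, Y ∈ A, exp(s • X) · exp(s • Y) = exp(s • (X + Y) + (s²/2) • [X, Y] + (s³/12) • [X − Y, [X, Y]]), where [a, b] = a·b − b·a. (Paper: Theorem 7.3 = Theorem 8.3, the third-order Baker–Campbell–Hausdorff formula.) -/
theorem nilExp_smul_four {R A : Type*} [CommRing R] [Algebra ℚ R]
    [Ring A] [Algebra R A] (s c : R) (hs : s ^ 4 = 0) (hc : c = (1 / 12 : ℚ) • (1 : R)) (W : A) :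
    nilExp R (s • W) =
      1 + s • W + (6 * c * s ^ 2) • (W * W) + (2 * c * s ^ 3) • (W * W * W) := by
  have h0 : (s • W) ^ 4 = 0 := by rw [smul_pow, hs, zero_smul]
  have h6 : ((1 / 2 : ℚ)) • (1 : R) = 6 * c := by
    rw [hc, Algebra.smul_def, Algebra.smul_def, mul_one, mul_one,
      show (6 : R) = algebraMap ℚ R 6 from (map_ofNat _ _).symm, ← map_mul]
    norm_num
  have h2 : ((1 / 6 : ℚ)) • (1 : R) = 2 * c := by
    rw [hc, Algebra.smul_def, Algebra.smul_def, mul_one, mul_one,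
      show (2 : R) = algebraMap ℚ R 2 from (map_ofNat _ _).symm, ← map_mul]
    norm_num
  have h : nilExp R (s • W) =
      ∑ k ∈ Finset.range 4, (((k.factorial : ℚ))⁻¹ • (1 : R)) • (s • W) ^ k := by
    unfold nilExp
    refine Finset.sum_subset ?_ ?_
    · intro k hk
      have : nilpotencyClass (s • W) ≤ 4 := csInf_le' h0
      simp only [Finset.mem_range] at *
      omega
    · intro k _ hk
      simp only [Finset.mem_range, not_lt] at hk
      rw [pow_eq_zero_of_le hk (pow_nilpotencyClass ⟨4, h0⟩), smul_zero]
  rw [h]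
  simp only [Finset.sum_range_succ, Finset.sum_range_zero, smul_pow]
  have e2 : (((Nat.factorial 2 : ℕ) : ℚ))⁻¹ = 1 / 2 := by norm_num [Nat.factorial]
  have e3 : (((Nat.factorial 3 : ℕ) : ℚ))⁻¹ = 1 / 6 := by norm_num [Nat.factorial]
  rw [e2, e3, h6, h2]
  simp [pow_succ, smul_smul, mul_assoc]

theorem bch_order_three {R A : Type*} [CommRing R] [Algebra ℚ R]
    [Ring A] [Algebra R A] (d₁ d₂ d₃ : R)
    (h₁ : d₁ ^ 2 = 0) (h₂ : d₂ ^ 2 = 0) (h₃ : d₃ ^ 2 = 0) (X Y : A) :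
    nilExp R ((d₁ + d₂ + d₃) • X) * nilExp R ((d₁ + d₂ + d₃) • Y) =
      nilExp R ((d₁ + d₂ + d₃) • (X + Y) + ((1 / 2 : ℚ) • (d₁ + d₂ + d₃) ^ 2) • br X Y +
        ((1 / 12 : ℚ) • (d₁ + d₂ + d₃) ^ 3) • br (X - Y) (br X Y)) := by
  have hs : (d₁ + d₂ + d₃) ^ 4 = 0 := by grind
  generalize d₁ + d₂ + d₃ = s at hs
  obtain ⟨c, hc⟩ : ∃ c : R, c = (1 / 12 : ℚ) • (1 : R) := ⟨_, rfl⟩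
  have hc1 : 12 * c = 1 := by
    rw [hc, Algebra.smul_def, mul_one, show (12 : R) = algebraMap ℚ R 12 from (map_ofNat _ _).symm, ← map_mul]
    norm_num
  have k2 : (1 / 2 : ℚ) • s ^ 2 = s * (6 * c * s) := by
    rw [hc, Algebra.smul_def, Algebra.smul_def, mul_one,
      show (6 : R) = algebraMap ℚ R 6 from (map_ofNat _ _).symm, ← map_mul]
    norm_num
    ring
  have k3 : (1 / 12 : ℚ) • s ^ 3 = s * (c * s ^ 2) := by
    rw [hc, Algebra.smul_def, Algebra.smul_def, mul_one]
    ring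
  rw [k2, k3, mul_smul s (6 * c * s), mul_smul s (c * s ^ 2), ← smul_add, ← smul_add]
  rw [nilExp_smul_four s c hs hc, nilExp_smul_four s c hs hc, nilExp_smul_four s c hs hc]
  have hW2 : ∀ P B C : A, (6 * c * s ^ 2) •
      ((P + (6 * c * s) • B + (c * s ^ 2) • C) * (P + (6 * c * s) • B + (c * s ^ 2) • C)) =
      (6 * c * s ^ 2) • (P * P) + (36 * c ^ 2 * s ^ 3) • (P * B + B * P) := by
    intro P B C
    simp only [mul_add, add_mul, smul_mul_assoc, mul_smul_comm, smul_add, smul_smul]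
    match_scalars <;> grind
  have hW3 : ∀ P B C : A, (2 * c * s ^ 3) •
      ((P + (6 * c * s) • B + (c * s ^ 2) • C) * (P + (6 * c * s) • B + (c * s ^ 2) • C)
        * (P + (6 * c * s) • B + (c * s ^ 2) • C)) =
      (2 * c * s ^ 3) • (P * P * P) := by
    intro P B C
    simp only [mul_add, add_mul, smul_mul_assoc, mul_smul_comm, smul_add, smul_smul]
    match_scalars <;> grind
  rw [hW2, hW3]
  simp only [br, mul_add, add_mul, mul_sub, sub_mul, smul_mul_assoc, mul_smul_comm, smul_add,
    smul_sub, smul_smul, mul_one, one_mul, mul_assoc]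
  match_scalars <;> grind
end

section
/- Let A be an associative unital ℚ-algebra and a ∈ A nilpotent. Then for every b ∈ A, exp(a) · b · exp(−a) = Σ_{k=0}^{N} (1/k!) • (ad a)ᵏ(b), where ad a : A → A is the map x ↦ a·x − x·a, and N is any natural number with (ad a)^{N+1} = 0 (such N exists since a is nilpotent). In other words, conjugation by exp(a) equals the exponential of the operator ad a. (Paper: Proposition 4.4, Ad(exp X) = e^{ad X}, in its algebra form.) -/
theorem nilExp_eq_exp {A : Type*} [Ring A] [Algebra ℚ A] (a : A) :
    nilExp ℚ a = IsNilpotent.exp a := by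
  simp [nilExp, IsNilpotent.exp]

theorem exp_conj_eq_exp_ad {A : Type*} [Ring A] [Algebra ℚ A]
    (a : A) (ha : IsNilpotent a) (N : ℕ)
    (hN : ∀ x : A, (fun x => a * x - x * a)^[N + 1] x = 0) (b : A) :
    nilExp ℚ a * b * nilExp ℚ (-a) =
      ∑ k ∈ Finset.range (N + 1),
        ((k.factorial : ℚ))⁻¹ • (fun x => a * x - x * a)^[k] b := by
  have hL : IsNilpotent (LinearMap.mulLeft ℚ a) := by
    obtain ⟨n, hn⟩ := ha
    exact ⟨n, by rw [LinearMap.pow_mulLeft, hn, LinearMap.mulLeft_zero_eq_zero]⟩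
  have hR : IsNilpotent (LinearMap.mulRight ℚ (-a)) := by
    obtain ⟨n, hn⟩ := ha.neg
    exact ⟨n, by rw [LinearMap.pow_mulRight, hn, LinearMap.mulRight_zero_eq_zero]⟩
  have hc : Commute (LinearMap.mulLeft ℚ a) (LinearMap.mulRight ℚ (-a)) :=
    LinearMap.commute_mulLeft_right a (-a)
  have hit : ∀ (k : ℕ) (x : A),
      ((LinearMap.mulLeft ℚ a + LinearMap.mulRight ℚ (-a)) ^ k) x
        = (fun x => a * x - x * a)^[k] x := by
    intro k x
    rw [Module.End.pow_apply]
    congr 1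
    congr 1
    funext y
    simp [sub_eq_add_neg]
  have hz : (LinearMap.mulLeft ℚ a + LinearMap.mulRight ℚ (-a)) ^ (N + 1) = 0 := by
    ext x
    rw [hit, hN, LinearMap.zero_apply]
  have key := IsNilpotent.exp_add_of_commute hc hL hR
  have eL : ∀ x : A, IsNilpotent.exp (LinearMap.mulLeft ℚ a) x = IsNilpotent.exp a * x := by
    intro x
    obtain ⟨n, hn⟩ := ha
    have h1 : (LinearMap.mulLeft ℚ a) ^ n = 0 := by
      rw [LinearMap.pow_mulLeft, hn, LinearMap.mulLeft_zero_eq_zero]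
    rw [IsNilpotent.exp_eq_sum hn, IsNilpotent.exp_eq_sum h1]
    simp [LinearMap.sum_apply, Finset.sum_mul, LinearMap.pow_mulLeft]
  have eR : ∀ x : A, IsNilpotent.exp (LinearMap.mulRight ℚ (-a)) x
      = x * IsNilpotent.exp (-a) := by
    intro x
    obtain ⟨n, hn⟩ := ha.neg
    have h1 : (LinearMap.mulRight ℚ (-a)) ^ n = 0 := by
      rw [LinearMap.pow_mulRight, hn, LinearMap.mulRight_zero_eq_zero]
    rw [IsNilpotent.exp_eq_sum hn, IsNilpotent.exp_eq_sum h1]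
    simp only [LinearMap.sum_apply, Finset.mul_sum, LinearMap.pow_mulRight,
      LinearMap.smul_apply, LinearMap.mulRight_apply, mul_smul_comm]
  rw [nilExp_eq_exp, nilExp_eq_exp, mul_assoc, ← eR, ← eL, ← Module.End.mul_apply, ← key,
    IsNilpotent.exp_eq_sum hz]
  simp only [LinearMap.sum_apply, LinearMap.smul_apply, hit]
end

section
/- Let R be a commutative ring that is a ℚ-algebra, A an associative unital R-algebra, X ∈ A a nilpotent element, and N a natural number with (ad X)^{N+1} = 0, where ad X : A → A is x ↦ X·x − x·X. Then for every d ∈ R with d² = 0 and every Y ∈ A, exp(X + d • Y) = exp(X) · exp(d • Σ_{p=0}^{N} ((−1)ᵖ/(p+1)!) • (ad X)ᵖ(Y)). (Paper: Theorem 5.2, the left logarithmic derivative of the exponential mapping, in its infinitesimal algebra form.) -/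
theorem nilExp_eq_sum' {R A : Type*} [CommRing R] [Algebra ℚ R]
    [Ring A] [Algebra R A] {a : A} {k : ℕ} (h : a ^ k = 0) :
    nilExp R a = ∑ i ∈ Finset.range k, algebraMap ℚ R ((i.factorial : ℚ)⁻¹) • a ^ i := by
  unfold nilExp
  simp only [← Algebra.algebraMap_eq_smul_one]
  refine Finset.sum_subset ?_ ?_
  · exact Finset.range_subset_range.2 (csInf_le' h)
  · intro i _ hi
    rw [pow_eq_zero_of_le (by simpa using hi) (pow_nilpotencyClass ⟨k, h⟩), smul_zero]

/-- The first-order coefficient of `(X + d Y)^(n+1)`. -/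
theorem pow_add_infinitesimal {R A : Type*} [CommRing R]
    [Ring A] [Algebra R A] (X : A) (d : R) (hd : d ^ 2 = 0) (b : ℕ → A)
    (hb : ∀ p, b p * X = X * b p - b (p + 1)) (n : ℕ) :
    (X + d • b 0) ^ (n + 1) = X ^ (n + 1) + d • ∑ p ∈ Finset.range (n + 1),
      (((n + 1).choose (p + 1) : R) * (-1) ^ p) • (X ^ (n - p) * b p) := by
  induction n with
  | zero => simp
  | succ n ih =>
    have key : ∑ p ∈ Finset.range (n + 1 + 1),
        (((n + 1 + 1).choose (p + 1) : R) * (-1) ^ p) • (X ^ (n + 1 - p) * b p) =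
        (∑ p ∈ Finset.range (n + 1),
          (((n + 1).choose (p + 1) : R) * (-1) ^ p) • (X ^ (n - p) * b p)) * X
          + X ^ (n + 1) * b 0 := by
      have h1 : ∀ p ∈ Finset.range (n + 1 + 1),
          (((n + 1 + 1).choose (p + 1) : R) * (-1) ^ p) • (X ^ (n + 1 - p) * b p) =
          (((n + 1).choose p : R) * (-1) ^ p) • (X ^ (n + 1 - p) * b p) +
          (((n + 1).choose (p + 1) : R) * (-1) ^ p) • (X ^ (n + 1 - p) * b p) := by
        intro p _
        rw [← add_smul, Nat.choose_succ_succ (n + 1) p]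
        push_cast
        rw [add_mul]
      rw [Finset.sum_congr rfl h1, Finset.sum_add_distrib, Finset.sum_range_succ',
        Finset.sum_range_succ (fun p => (((n + 1).choose (p + 1) : R) * (-1) ^ p) •
          (X ^ (n + 1 - p) * b p)), Finset.sum_mul]
      have h2 : ∀ p ∈ Finset.range (n + 1),
          ((((n + 1).choose (p + 1) : R) * (-1) ^ p) • (X ^ (n - p) * b p)) * X =
          (((n + 1).choose (p + 1) : R) * (-1) ^ (p + 1)) • (X ^ (n + 1 - (p + 1)) * b (p + 1)) +
          (((n + 1).choose (p + 1) : R) * (-1) ^ p) • (X ^ (n + 1 - p) * b p) := by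
        intro p hp
        have hp' : n + 1 - p = (n - p) + 1 := by
          have := Finset.mem_range.1 hp
          omega
        rw [smul_mul_assoc, mul_assoc, hb, hp', Nat.add_sub_add_right, pow_succ (-1 : R),
          mul_sub, smul_sub, pow_succ X, mul_assoc (X ^ (n - p)) X]
        simp only [mul_neg, mul_one, neg_smul]
        abel
      rw [Finset.sum_congr rfl h2, Finset.sum_add_distrib]
      simp
      abel
    rw [key, pow_succ, ih]
    generalize (∑ p ∈ Finset.range (n + 1),
          (((n + 1).choose (p + 1) : R) * (-1) ^ p) • (X ^ (n - p) * b p)) = S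
    rw [add_mul, mul_add, mul_add, ← pow_succ, smul_mul_smul_comm, ← pow_two, hd, zero_smul,
      smul_add, smul_mul_assoc, mul_smul_comm]
    abel

theorem exp_add_infinitesimal_left {R A : Type*} [CommRing R] [Algebra ℚ R]
    [Ring A] [Algebra R A] (X : A) (hX : IsNilpotent X) (N : ℕ)
    (hN : ∀ z : A, (fun x => X * x - x * X)^[N + 1] z = 0)
    (d : R) (hd : d ^ 2 = 0) (Y : A) :
    nilExp R (X + d • Y) =
      nilExp R X *
        nilExp R (d • ∑ p ∈ Finset.range (N + 1),
          ((((-1 : ℚ) ^ p / (p + 1).factorial) • (1 : R)) •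
            (fun x => X * x - x * X)^[p] Y)) := by
  obtain ⟨K, hK⟩ := hX
  obtain ⟨b, hbdef⟩ : ∃ b : ℕ → A, ∀ p, b p = (fun x => X * x - x * X)^[p] Y := ⟨_, fun _ => rfl⟩
  have hb0 : b 0 = Y := by simp [hbdef]
  have hb : ∀ p, b p * X = X * b p - b (p + 1) := by
    intro p
    rw [hbdef (p + 1), Function.iterate_succ_apply', ← hbdef p]
    simp
  have hbN : ∀ p, N + 1 ≤ p → b p = 0 := by
    intro p hp
    obtain ⟨k, rfl⟩ := Nat.exists_eq_add_of_le hp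
    rw [hbdef, Function.iterate_add_apply, hN]
  have hXK : ∀ i, K ≤ i → X ^ i = 0 := fun i hi => pow_eq_zero_of_le hi hK
  simp only [← hbdef, ← Algebra.algebraMap_eq_smul_one]
  rw [← hb0]
  have hpow := pow_add_infinitesimal X d hd b hb
  have hM : (X + d • b 0) ^ (K + N + 1 + 1) = 0 := by
    rw [hpow, hXK _ (by omega), zero_add, Finset.sum_eq_zero, smul_zero]
    intro p _
    rcases le_or_gt (N + 1) p with h | h
    · rw [hbN p h, mul_zero, smul_zero]
    · rw [hXK _ (by omega), zero_mul, smul_zero]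
  generalize hZ : ∑ p ∈ Finset.range (N + 1),
    algebraMap ℚ R ((-1 : ℚ) ^ p / (p + 1).factorial) • b p = Z
  have hZ2 : (d • Z) ^ 2 = 0 := by rw [smul_pow, hd, zero_smul]
  have hXM : X ^ (K + N + 1 + 1) = 0 := hXK _ (by omega)
  rw [nilExp_eq_sum' hZ2, nilExp_eq_sum' hM]
  have hE : ∑ i ∈ Finset.range 2, algebraMap ℚ R ((i.factorial : ℚ)⁻¹) • (d • Z) ^ i
      = 1 + d • Z := by simp [Finset.sum_range_succ]
  rw [hE, mul_add, mul_one]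
  conv_rhs => enter [1]; rw [nilExp_eq_sum' hXM]
  rw [nilExp_eq_sum' hK, Finset.sum_range_succ', Finset.sum_range_succ' _ (K + N + 1)]
  simp only [hpow, smul_add, Finset.sum_add_distrib]
  have main : ∑ n ∈ Finset.range (K + N + 1), algebraMap ℚ R (((n + 1).factorial : ℚ)⁻¹) •
      d • ∑ p ∈ Finset.range (n + 1),
        (((n + 1).choose (p + 1) : R) * (-1) ^ p) • (X ^ (n - p) * b p) =
      (∑ i ∈ Finset.range K, algebraMap ℚ R ((i.factorial : ℚ)⁻¹) • X ^ i) * d • Z := by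
    let f : ℕ → ℕ → A := fun p i =>
      (algebraMap ℚ R ((-1 : ℚ) ^ p / (p + 1).factorial) *
        algebraMap ℚ R ((i.factorial : ℚ)⁻¹)) • (X ^ i * b p)
    have h1 : ∀ n ∈ Finset.range (K + N + 1), algebraMap ℚ R (((n + 1).factorial : ℚ)⁻¹) •
      d • ∑ p ∈ Finset.range (n + 1),
        (((n + 1).choose (p + 1) : R) * (-1) ^ p) • (X ^ (n - p) * b p) =
        d • ∑ p ∈ Finset.range (n + 1), f p (n - p) := by
      intro n _
      rw [smul_comm, Finset.smul_sum]
      congr 1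
      refine Finset.sum_congr rfl fun p hp => ?_
      have hp' : p + 1 ≤ n + 1 := Finset.mem_range.1 hp
      simp only [f]
      rw [smul_smul]
      congr 1
      have e1 : (((n + 1).choose (p + 1) : R) * (-1) ^ p) =
        algebraMap ℚ R (((n + 1).choose (p + 1) : ℚ) * (-1) ^ p) := by simp
      rw [e1, ← map_mul, ← map_mul, Nat.cast_choose ℚ hp', Nat.add_sub_add_right]
      congr 1
      have := Nat.factorial_ne_zero (n + 1)
      field_simp
    rw [Finset.sum_congr rfl h1, ← Finset.smul_sum, Finset.sum_range_diag_flip, mul_smul_comm]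
    congr 1
    have h2 : ∑ p ∈ Finset.range (N + 1), ∑ i ∈ Finset.range (K + N + 1 - p), f p i =
        ∑ p ∈ Finset.range (K + N + 1), ∑ i ∈ Finset.range (K + N + 1 - p), f p i := by
      refine Finset.sum_subset (Finset.range_subset_range.2 (by omega)) ?_
      intro p _ hp
      refine Finset.sum_eq_zero fun i _ => ?_
      simp only [f]
      rw [hbN p (by simpa using hp), mul_zero, smul_zero]
    rw [← h2, ← hZ, Finset.mul_sum]
    refine Finset.sum_congr rfl fun p hp => ?_
    have hp' := Finset.mem_range.1 hp
    rw [Finset.sum_mul]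
    symm
    have h3 : ∑ i ∈ Finset.range K, f p i = ∑ i ∈ Finset.range (K + N + 1 - p), f p i := by
      refine Finset.sum_subset (Finset.range_subset_range.2 (by omega)) ?_
      intro i _ hi
      simp only [f]
      rw [hXK i (by simpa using hi), zero_mul, smul_zero]
    rw [← h3]
    refine Finset.sum_congr rfl fun i _ => ?_
    simp only [f]
    rw [smul_mul_smul_comm, mul_comm (algebraMap ℚ R _)]
  rw [main]
  simp only [pow_zero]
  abel
end
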